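/- arXiv:2210.15847 — 4 statements merged into one kernel-verified Lean document; each statement's English description precedes it below -/
import Mathlib

section
/- Let V be a unitary N×N complex matrix, and let A = V Λ_A V*, B = V Λ_B V* with Λ_A, Λ_B diagonal complex matrices. Fix z ∈ ℂ and let X, U be complex N×N matrices satisfying (zI − A)X − BU = I. Define Λ_x' to be the diagonal matrix whose diagonal agrees with that of V* X V (all off-diagonal entries set to zero), Λ_u' the diagonal matrix whose diagonal agrees with that of V* U V, and set X' = V Λ_x' V*, U' = V Λ_u' V*. Then (zI − A)X' − BU' = I. -/
open Matrix

/-- Extracting the diagonal commutes with left multiplication by a diagonal matrix. -/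
theorem Matrix.IsDiag.mul_diagonal_diag {n R : Type*} [Fintype n] [DecidableEq n] [Semiring R]
    {D : Matrix n n R} (hD : D.IsDiag) (M : Matrix n n R) :
    D * diagonal (diag M) = diagonal (diag (D * M)) := by
  obtain ⟨d, rfl⟩ : ∃ d, D = diagonal d := ⟨_, hD.diagonal_diag.symm⟩
  rw [diagonal_mul_diagonal]
  congr 1
  ext i
  simp [diagonal_mul]

/-- **Diagonal spectral projections preserve the SLS achievability constraint.**
Let `V` be unitary, `A = V * DA * Vᴴ`, `B = V * DB * Vᴴ` with `DA`, `DB` diagonal.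
If `(X, U)` satisfy the pointwise-in-frequency achievability constraint
`(z • 1 - A) * X - B * U = 1`, then so do their diagonal spectral projections
`X' = V * diagonal (diag (Vᴴ * X * V)) * Vᴴ` and
`U' = V * diagonal (diag (Vᴴ * U * V)) * Vᴴ`. -/
theorem diagonal_projection_preserves_achievability
    (N : ℕ) (V DA DB : Matrix (Fin N) (Fin N) ℂ)
    (hV : V * Vᴴ = 1) (hV' : Vᴴ * V = 1)
    (hDA : DA.IsDiag) (hDB : DB.IsDiag)
    (A B : Matrix (Fin N) (Fin N) ℂ)
    (hA : A = V * DA * Vᴴ) (hB : B = V * DB * Vᴴ)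
    (z : ℂ) (X U : Matrix (Fin N) (Fin N) ℂ)
    (hach : (z • 1 - A) * X - B * U = 1) :
    (z • 1 - A) * (V * Matrix.diagonal (Matrix.diag (Vᴴ * X * V)) * Vᴴ)
      - B * (V * Matrix.diagonal (Matrix.diag (Vᴴ * U * V)) * Vᴴ) = 1 := by
  subst hA hB
  have hcancel : ∀ M : Matrix (Fin N) (Fin N) ℂ, Vᴴ * (V * M) = M := fun M => by
    rw [← Matrix.mul_assoc, hV', Matrix.one_mul]
  have hshift : (z • 1 - V * DA * Vᴴ) = V * (z • 1 - DA) * Vᴴ := by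
    simp [Matrix.mul_sub, Matrix.sub_mul, hV]
  have hdiag : (z • 1 - DA).IsDiag := (isDiag_one.smul z).sub hDA
  rw [hshift] at hach ⊢
  have hmodal : (z • 1 - DA) * (Vᴴ * X * V) - DB * (Vᴴ * U * V) = 1 := by
    have h := congrArg (fun M => Vᴴ * M * V) hach
    simpa only [Matrix.mul_sub, Matrix.sub_mul, Matrix.mul_assoc, hcancel, Matrix.one_mul,
      hV'] using h
  have hproj : (z • 1 - DA) * diagonal (diag (Vᴴ * X * V))
      - DB * diagonal (diag (Vᴴ * U * V)) = 1 := by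
    rw [hdiag.mul_diagonal_diag, hDB.mul_diagonal_diag, diagonal_sub, ← diagonal_one]
    exact congrArg (fun M => diagonal (diag M)) hmodal |>.trans (by simp)
  calc
    _ = V * ((z • 1 - DA) * diagonal (diag (Vᴴ * X * V))
          - DB * diagonal (diag (Vᴴ * U * V))) * Vᴴ := by
      simp only [Matrix.mul_sub, Matrix.sub_mul, Matrix.mul_assoc, hcancel]
    _ = 1 := by rw [hproj, Matrix.mul_one, hV]
end

section
/- Let S be a real symmetric N×N matrix whose eigenvalues λ_1, …, λ_N are pairwise distinct, and let 1 ≤ F ≤ N. Fix d ∈ ℝ^N and consider the function f : ℝ^F → ℝ defined by f(c) = ‖Σ_{k=0}^{F−1} c_k S^k − Σ_{l=0}^{N−1} d_l S^l‖_F². For each i, let λ_{iF} = (1, λ_i, …, λ_i^{F−1}) ∈ ℝ^F and λ_{i(N−F)} = (λ_i^F, …, λ_i^{N−1}) ∈ ℝ^{N−F}, and let d_head = (d_0, …, d_{F−1}) and d_tail = (d_F, …, d_{N−1}). Then f has a unique global minimizer c* ∈ ℝ^F, given by c* = d_head + ε, where ε = (Σ_{i=1}^N λ_{iF} λ_{iF}ᵀ)^{−1}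 (Σ_{i=1}^N λ_{iF} λ_{i(N−F)}ᵀ) d_tail. -/
open Matrix

/-- Powers commute with orthogonal diagonalization. -/
theorem orthogonal_conj_diagonal_pow {n : Type*} [Fintype n] [DecidableEq n]
    (V : Matrix n n ℝ) (lam : n → ℝ) (hV : V * Vᵀ = 1) (hV' : Vᵀ * V = 1) (k : ℕ) :
    (V * diagonal lam * Vᵀ) ^ k = V * diagonal (fun i => lam i ^ k) * Vᵀ := by
  induction k with
  | zero => simp [hV]
  | succ k ih =>
    calc (V * diagonal lam * Vᵀ) ^ (k + 1)
        = V * diagonal (fun i => lam i ^ k) * (Vᵀ * V) * diagonal lam * Vᵀ := by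
          rw [pow_succ, ih]; simp only [Matrix.mul_assoc]
      _ = V * diagonal (fun i => lam i ^ (k + 1)) * Vᵀ := by
          rw [hV', Matrix.mul_one, Matrix.mul_assoc V, diagonal_mul_diagonal]
          simp only [pow_succ]

/-- A linear combination of powers of an orthogonally diagonalized matrix. -/
theorem sum_smul_orthogonal_conj_diagonal_pow {n : Type*} [Fintype n] [DecidableEq n]
    (V : Matrix n n ℝ) (lam : n → ℝ) (hV : V * Vᵀ = 1) (hV' : Vᵀ * V = 1)
    (m : ℕ) (c : Fin m → ℝ) :
    ∑ k : Fin m, c k • (V * diagonal lam * Vᵀ) ^ (k : ℕ) =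
      V * diagonal (fun i => ∑ k : Fin m, c k * lam i ^ (k : ℕ)) * Vᵀ := by
  have h : diagonal (fun i => ∑ k : Fin m, c k * lam i ^ (k : ℕ)) =
      ∑ k : Fin m, c k • diagonal (fun i => lam i ^ (k : ℕ)) := by
    ext i j
    rw [Matrix.sum_apply]
    by_cases hij : i = j
    · subst hij; simp
    · simp [hij]
  simp only [h, orthogonal_conj_diagonal_pow V lam hV hV', Matrix.mul_sum, Matrix.sum_mul,
    Matrix.mul_smul, Matrix.smul_mul]

/-- The squared Frobenius norm of an orthogonally diagonalized matrix. -/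
theorem sum_sq_orthogonal_conj_diagonal {n : Type*} [Fintype n] [DecidableEq n]
    (V : Matrix n n ℝ) (mu : n → ℝ) (hV' : Vᵀ * V = 1) :
    ∑ i, ∑ j, ((V * diagonal mu * Vᵀ) i j) ^ 2 = ∑ i, mu i ^ 2 := by
  have key : (V * diagonal mu * Vᵀ) * (V * diagonal mu * Vᵀ)ᵀ =
      V * (diagonal (fun i => mu i * mu i) * Vᵀ) := by
    calc _ = V * (diagonal mu * ((Vᵀ * V) * (diagonal mu * Vᵀ))) := by
          simp only [transpose_mul, transpose_transpose, diagonal_transpose, Matrix.mul_assoc]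
      _ = _ := by
          rw [hV', Matrix.one_mul, ← Matrix.mul_assoc (diagonal mu), diagonal_mul_diagonal]
  have htr := congrArg trace key
  rw [trace_mul_comm V, Matrix.mul_assoc (diagonal _) Vᵀ V, hV', Matrix.mul_one,
    trace_diagonal] at htr
  simpa only [trace, diag_apply, Matrix.mul_apply (M := V * diagonal mu * Vᵀ),
    transpose_apply, ← sq] using htr

/-- Pythagorean identity for a solution `e` of the normal equations. -/
theorem sum_sq_mulVec_sub_of_normal_eq {m n : Type*} [Fintype m] [Fintype n]
    (A : Matrix m n ℝ) (b : m → ℝ) (e x : n → ℝ) (he : (Aᵀ * A) *ᵥ e = Aᵀ *ᵥ b) :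
    ∑ i, ((A *ᵥ x) i - b i) ^ 2 =
      ∑ i, ((A *ᵥ e) i - b i) ^ 2 + ∑ i, ((A *ᵥ (x - e)) i) ^ 2 := by
  have horth : (A *ᵥ (x - e)) ⬝ᵥ (A *ᵥ e - b) = 0 := by
    rw [dotProduct_comm, dotProduct_mulVec, ← mulVec_transpose, mulVec_sub, mulVec_mulVec, he,
      sub_self, zero_dotProduct]
  have h2 : ∑ i, (A *ᵥ (x - e)) i * ((A *ᵥ e) i - b i) = 0 := horth
  calc _ = ∑ i, (((A *ᵥ e) i - b i) ^ 2 + ((A *ᵥ (x - e)) i) ^ 2 +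
          2 * ((A *ᵥ (x - e)) i * ((A *ᵥ e) i - b i))) := by
        refine Finset.sum_congr rfl fun i _ => ?_
        rw [mulVec_sub, Pi.sub_apply]; ring
    _ = _ := by
        rw [Finset.sum_add_distrib, Finset.sum_add_distrib, ← Finset.mul_sum, h2]; ring

/-- A tall Vandermonde matrix with distinct nodes has injective action on vectors. -/
theorem mulVec_injective_of_pow {N F : ℕ} (hFN : F ≤ N) (lam : Fin N → ℝ)
    (hdist : Function.Injective lam) :
    Function.Injective
      (Matrix.of fun (i : Fin N) (k : Fin F) => lam i ^ (k : ℕ)).mulVec := by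
  intro x y hxy
  rw [← sub_eq_zero]
  refine eq_zero_of_forall_index_sum_pow_mul_eq_zero
    (f := fun i : Fin F => lam (Fin.castLE hFN i))
    (hdist.comp (Fin.castLE_injective hFN)) fun j => ?_
  have h := congrFun hxy (Fin.castLE hFN j)
  rw [← sub_eq_zero, ← Pi.sub_apply, ← mulVec_sub] at h
  exact h

/-- Splitting a sum over `Fin N` into its first `F` and last `N - F` terms. -/
theorem sum_fin_split {N F : ℕ} (hFN : F ≤ N) (g : Fin N → ℝ) :
    ∑ l, g l = ∑ k : Fin F, g (Fin.castLE hFN k) +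
      ∑ l : Fin (N - F), g (Fin.cast (Nat.add_sub_cancel' hFN) (Fin.natAdd F l)) := by
  rw [← (finCongr (Nat.add_sub_cancel' hFN)).sum_comp, Fin.sum_univ_add]
  rfl

/-- **Closed form of the optimal projection onto order-`F` graph filters.**
Let `S = V * diagonal lam * Vᵀ` with `V` orthogonal and `lam` pairwise distinct,
and let `1 ≤ F ≤ N`.  For `d : Fin N → ℝ`, the squared-Frobenius projection cost
`f c = ‖∑_{k<F} c k S^k - ∑_{l<N} d l S^l‖_F²` has a unique global minimizer
`c* = d_head + ε`, where `ε = (∑ᵢ λ_{iF} λ_{iF}ᵀ)⁻¹ (∑ᵢ λ_{iF} λ_{i(N-F)}ᵀ) d_tail`. -/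
theorem graph_filter_projection_closed_form
    (N F : ℕ) (hF : 1 ≤ F) (hFN : F ≤ N)
    (S V : Matrix (Fin N) (Fin N) ℝ) (lam : Fin N → ℝ)
    (hV : V * Vᵀ = 1) (hV' : Vᵀ * V = 1)
    (hS : S = V * Matrix.diagonal lam * Vᵀ)
    (hdist : Function.Injective lam)
    (d : Fin N → ℝ) :
    let f : (Fin F → ℝ) → ℝ := fun c =>
      ∑ i, ∑ j,
        ((∑ k : Fin F, c k • S ^ (k : ℕ) - ∑ l : Fin N, d l • S ^ (l : ℕ)) i j) ^ 2
    let M : Matrix (Fin F) (Fin F) ℝ :=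
      Matrix.of fun k l : Fin F => ∑ i : Fin N, lam i ^ ((k : ℕ) + (l : ℕ))
    let C : Matrix (Fin F) (Fin (N - F)) ℝ :=
      Matrix.of fun (k : Fin F) (l : Fin (N - F)) =>
        ∑ i : Fin N, lam i ^ ((k : ℕ) + (F + (l : ℕ)))
    let dtail : Fin (N - F) → ℝ := fun l =>
      d (Fin.cast (Nat.add_sub_cancel' hFN) (Fin.natAdd F l))
    let eps : Fin F → ℝ := M⁻¹ *ᵥ (C *ᵥ dtail)
    let cstar : Fin F → ℝ := fun k => d (Fin.castLE hFN k) + eps k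
    (∀ c : Fin F → ℝ, f cstar ≤ f c) ∧
      (∀ c : Fin F → ℝ, f c = f cstar → c = cstar) := by
  intro f M C dtail eps cstar
  let A : Matrix (Fin N) (Fin F) ℝ := Matrix.of fun i k => lam i ^ (k : ℕ)
  let B : Matrix (Fin N) (Fin (N - F)) ℝ := Matrix.of fun i l => lam i ^ (F + (l : ℕ))
  have hAinj : Function.Injective A.mulVec := mulVec_injective_of_pow hFN lam hdist
  have hM : M = Aᵀ * A := by
    ext k l
    simp [M, A, Matrix.mul_apply, pow_add]
  have hC : C = Aᵀ * B := by
    ext k l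
    simp [C, A, B, Matrix.mul_apply, pow_add]
  have hMunit : IsUnit M := by
    rw [hM]
    simpa using (PosDef.conjTranspose_mul_self A hAinj).isUnit
  have heps : (Aᵀ * A) *ᵥ eps = Aᵀ *ᵥ (B *ᵥ dtail) := by
    rw [mulVec_mulVec dtail Aᵀ B, ← hM, ← hC, mulVec_mulVec, mulVec_mulVec,
      mul_nonsing_inv _ ((isUnit_iff_isUnit_det M).mp hMunit), Matrix.one_mul]
  let dhead : Fin F → ℝ := fun k => d (Fin.castLE hFN k)
  have hf : ∀ c, f c = ∑ i, ((A *ᵥ (c - dhead)) i - (B *ᵥ dtail) i) ^ 2 := by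
    intro c
    simp only [f, hS, sum_smul_orthogonal_conj_diagonal_pow V lam hV hV', ← Matrix.sub_mul,
      ← Matrix.mul_sub, diagonal_sub, sum_sq_orthogonal_conj_diagonal V _ hV']
    refine Finset.sum_congr rfl fun i _ => ?_
    rw [sum_fin_split hFN]
    simp [A, B, mulVec, dotProduct, dhead, dtail, mul_sub, mul_comm, sub_sub]
  have hstar : cstar - dhead = eps := by
    ext k
    simp [cstar, dhead]
  have hpyth : ∀ c, f c = f cstar + ∑ i, ((A *ᵥ (c - cstar)) i) ^ 2 := by
    intro c
    rw [hf c, hf cstar, hstar, sum_sq_mulVec_sub_of_normal_eq A _ eps (c - dhead) heps, ← hstar,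
      sub_sub_sub_cancel_right]
  refine ⟨fun c => ?_, fun c hc => ?_⟩
  · rw [hpyth c]
    exact le_add_of_nonneg_right (Finset.sum_nonneg fun i _ => sq_nonneg _)
  · rw [hpyth c, add_eq_left, Finset.sum_eq_zero_iff_of_nonneg fun i _ => sq_nonneg _] at hc
    rw [← sub_eq_zero]
    refine hAinj ?_
    rw [mulVec_zero]
    ext i
    exact pow_eq_zero_iff two_ne_zero |>.mp (hc i (Finset.mem_univ i))
end

section
/- Let A, B, X, U, Δ be complex N×N matrices and z ∈ ℂ, and suppose (zI − A)X − BU = I + Δ, X is invertible, and I + Δ is invertible. Let K = U X^{−1}. Then the matrix zI − A − BK is invertible, and (zI − A − BK)^{−1} = X (I + Δ)^{−1} and K (zI − A − BK)^{−1} = U (I + Δ)^{−1}. -/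
open Matrix

/-- **Robust SLS: closed-loop responses of approximate system responses.**
Suppose `(z • 1 - A) * X - B * U = 1 + Δ` with `X` and `1 + Δ` invertible, and let
`K = U * X⁻¹`.  Then `z • 1 - A - B * K` is invertible, with
`(z • 1 - A - B * K)⁻¹ = X * (1 + Δ)⁻¹` and
`K * (z • 1 - A - B * K)⁻¹ = U * (1 + Δ)⁻¹`. -/
theorem robust_sls_closed_loop
    (N : ℕ) (A B X U Δ : Matrix (Fin N) (Fin N) ℂ) (z : ℂ)
    (h : (z • 1 - A) * X - B * U = 1 + Δ)
    (hX : IsUnit X) (hΔ : IsUnit (1 + Δ)) :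
    IsUnit (z • 1 - A - B * (U * X⁻¹)) ∧
    (z • 1 - A - B * (U * X⁻¹))⁻¹ = X * (1 + Δ)⁻¹ ∧
    (U * X⁻¹) * (z • 1 - A - B * (U * X⁻¹))⁻¹ = U * (1 + Δ)⁻¹ := by
  have hXX : X⁻¹ * X = 1 := nonsing_inv_mul X ((isUnit_iff_isUnit_det X).mp hX)
  have hMX : (z • 1 - A - B * (U * X⁻¹)) * X = 1 + Δ := by
    rw [← h, sub_mul, Matrix.mul_assoc B, Matrix.mul_assoc U, hXX, Matrix.mul_one]
  have hinv : (z • 1 - A - B * (U * X⁻¹)) * (X * (1 + Δ)⁻¹) = 1 := by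
    rw [← Matrix.mul_assoc, hMX]
    exact mul_nonsing_inv _ ((isUnit_iff_isUnit_det _).mp hΔ)
  have hM := inv_eq_right_inv hinv
  refine ⟨IsUnit.of_mul_eq_one _ hinv, hM, ?_⟩
  rw [hM, Matrix.mul_assoc, ← Matrix.mul_assoc X⁻¹, hXX, Matrix.one_mul]
end

section
/- Let V be a unitary N×N complex matrix, let A = V Λ_A V* and B = V Λ_B V* with Λ_A, Λ_B diagonal, and let Q = V Λ_Q V*, R = V Λ_R V* with Λ_Q, Λ_R diagonal with nonnegative real entries. Fix z ∈ ℂ. Then for every pair of complex N×N matrices (X, U) satisfying (zI − A)X − BU = I, there exists a pair (X', U') satisfying (zI − A)X' − BU' = I such that both X' and U' are diagonalized by V and trace(X'^* Q X') + trace(U'^* R U') ≤ trace(X* Q X) + trace(U* R U); namely, X' = V · diag(V* X V) · V* and U' = V · diag(V* U V) · V*. -/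
open Matrix
open scoped ComplexOrder

/-- `Matrix.diagonal_sub` stated with pointwise subtraction of functions. -/
lemma diagonal_pi_sub {n α : Type*} [DecidableEq n] [AddGroup α] (d e : n → α) :
    diagonal d - diagonal e = diagonal (d - e) :=
  diagonal_sub d e

/-- Taking the diagonal part commutes with left multiplication by a diagonal matrix. -/
lemma diagonal_diag_diagonal_mul {n α : Type*} [Fintype n] [DecidableEq n]
    [NonUnitalNonAssocSemiring α] (d : n → α) (M : Matrix n n α) :
    diagonal (diag (diagonal d * M)) = diagonal d * diagonal (diag M) := by
  rw [diagonal_mul_diagonal]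
  congr 1
  funext i
  simp [diagonal_mul]

/-- A quadratic cost with a diagonal weight is the weighted sum of squared entries. -/
lemma trace_conjTranspose_mul_diagonal_mul {m n : Type*} [Fintype m] [Fintype n] [DecidableEq m]
    (q : m → ℝ) (Y : Matrix m n ℂ) :
    trace (Yᴴ * diagonal (fun i => (q i : ℂ)) * Y) =
      ((∑ j, ∑ i, q i * Complex.normSq (Y i j) : ℝ) : ℂ) := by
  rw [trace]
  push_cast
  refine Finset.sum_congr rfl fun j _ => ?_
  rw [diag_apply, mul_apply]
  refine Finset.sum_congr rfl fun i _ => ?_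
  rw [mul_diagonal, conjTranspose_apply, Complex.normSq_eq_conj_mul_self, starRingEnd_apply]
  ring

/-- Dropping the off-diagonal entries does not increase a quadratic cost with a nonnegative
diagonal weight. -/
lemma trace_diagonal_diag_le {n : Type*} [Fintype n] [DecidableEq n]
    (q : n → ℝ) (hq : ∀ i, 0 ≤ q i) (Y : Matrix n n ℂ) :
    trace ((diagonal (diag Y))ᴴ * diagonal (fun i => (q i : ℂ)) * diagonal (diag Y)) ≤
      trace (Yᴴ * diagonal (fun i => (q i : ℂ)) * Y) := by
  rw [trace_conjTranspose_mul_diagonal_mul, trace_conjTranspose_mul_diagonal_mul,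
    Complex.real_le_real]
  refine Finset.sum_le_sum fun j _ => Finset.sum_le_sum fun i _ =>
    mul_le_mul_of_nonneg_left ?_ (hq i)
  by_cases h : i = j
  · subst h
    simp
  · simp [diagonal_apply_ne _ h, Complex.normSq_nonneg]

/-- The quadratic cost is invariant under a unitary change of basis. -/
lemma trace_conj_unitary {n : Type*} [Fintype n] [DecidableEq n] {V : Matrix n n ℂ}
    (hV : V * Vᴴ = 1) (D X : Matrix n n ℂ) :
    trace (Xᴴ * (V * D * Vᴴ) * X) = trace ((Vᴴ * X * V)ᴴ * D * (Vᴴ * X * V)) := by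
  have h : (Vᴴ * X * V)ᴴ * D * (Vᴴ * X * V) = Vᴴ * (Xᴴ * (V * D * Vᴴ) * X * V) := by
    simp only [conjTranspose_mul, conjTranspose_conjTranspose, Matrix.mul_assoc]
  rw [h, trace_mul_comm Vᴴ, Matrix.mul_assoc _ V, hV, Matrix.mul_one]

/-- Undoing a unitary change of basis. -/
lemma conj_conj_unitary {n : Type*} [Fintype n] [DecidableEq n] {V : Matrix n n ℂ}
    (hV' : Vᴴ * V = 1) (D : Matrix n n ℂ) : Vᴴ * (V * D * Vᴴ) * V = D := by
  rw [← Matrix.mul_assoc, ← Matrix.mul_assoc, hV', Matrix.one_mul, Matrix.mul_assoc, hV',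
    Matrix.mul_one]

/-- The diagonal spectral projection does not increase a quadratic cost whose weight is
diagonalized by the same unitary matrix with nonnegative eigenvalues. -/
lemma trace_spectral_projection_le {n : Type*} [Fintype n] [DecidableEq n] {V : Matrix n n ℂ}
    (hV : V * Vᴴ = 1) (hV' : Vᴴ * V = 1) (q : n → ℝ) (hq : ∀ i, 0 ≤ q i) (X : Matrix n n ℂ) :
    trace ((V * diagonal (diag (Vᴴ * X * V)) * Vᴴ)ᴴ *
        (V * diagonal (fun i => (q i : ℂ)) * Vᴴ) * (V * diagonal (diag (Vᴴ * X * V)) * Vᴴ)) ≤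
      trace (Xᴴ * (V * diagonal (fun i => (q i : ℂ)) * Vᴴ) * X) := by
  rw [trace_conj_unitary hV, trace_conj_unitary hV, conj_conj_unitary hV']
  exact trace_diagonal_diag_le q hq _

/-- The diagonal spectral projection commutes with left multiplication by a matrix diagonalized
by the same unitary matrix. -/
lemma spectral_projection_mul {n : Type*} [Fintype n] [DecidableEq n] {V : Matrix n n ℂ}
    (hV' : Vᴴ * V = 1) {D : Matrix n n ℂ} (hD : D.IsDiag) (X : Matrix n n ℂ) :
    V * diagonal (diag (Vᴴ * (V * D * Vᴴ * X) * V)) * Vᴴ =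
      V * D * Vᴴ * (V * diagonal (diag (Vᴴ * X * V)) * Vᴴ) := by
  have h : Vᴴ * (V * D * Vᴴ * X) * V = D * (Vᴴ * X * V) := by
    simp only [← Matrix.mul_assoc, hV', Matrix.one_mul]
  have h' : V * D * Vᴴ * (V * diagonal (diag (Vᴴ * X * V)) * Vᴴ) =
      V * (D * diagonal (diag (Vᴴ * X * V))) * Vᴴ := by
    simp only [Matrix.mul_assoc]
    rw [← Matrix.mul_assoc Vᴴ V, hV', Matrix.one_mul]
  rw [h, h', ← hD.diagonal_diag, diagonal_diag_diagonal_mul]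

/-- **Graph symmetric LQR problems admit graph-symmetric optimal system responses
(frequency-pointwise form).**
Let `V` be unitary, `A = V * DA * Vᴴ`, `B = V * DB * Vᴴ` with `DA`, `DB` diagonal,
and `Q = V * diagonal q * Vᴴ`, `R = V * diagonal r * Vᴴ` with nonnegative real
entries `q`, `r`.  Then for every pair `(X, U)` satisfying the achievability
constraint `(z • 1 - A) * X - B * U = 1`, there is a pair `(X', U')`, both
diagonalized by `V`, that also satisfies the constraint and achieves a cost
`trace (X'ᴴ Q X') + trace (U'ᴴ R U')` at most that of `(X, U)`; namely the
diagonal spectral projections `X' = V * diagonal (diag (Vᴴ * X * V)) * Vᴴ` and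
`U' = V * diagonal (diag (Vᴴ * U * V)) * Vᴴ`. -/
theorem graph_symmetric_optimal_response
    (N : ℕ) (V DA DB : Matrix (Fin N) (Fin N) ℂ)
    (hV : V * Vᴴ = 1) (hV' : Vᴴ * V = 1)
    (hDA : DA.IsDiag) (hDB : DB.IsDiag)
    (A B : Matrix (Fin N) (Fin N) ℂ)
    (hA : A = V * DA * Vᴴ) (hB : B = V * DB * Vᴴ)
    (q r : Fin N → ℝ) (hq : ∀ i, 0 ≤ q i) (hr : ∀ i, 0 ≤ r i)
    (Q R : Matrix (Fin N) (Fin N) ℂ)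
    (hQ : Q = V * Matrix.diagonal (fun i => (q i : ℂ)) * Vᴴ)
    (hR : R = V * Matrix.diagonal (fun i => (r i : ℂ)) * Vᴴ)
    (z : ℂ) :
    ∀ X U : Matrix (Fin N) (Fin N) ℂ,
      (z • 1 - A) * X - B * U = 1 →
      ∃ X' U' : Matrix (Fin N) (Fin N) ℂ,
        ((z • 1 - A) * X' - B * U' = 1) ∧
        (∃ Dx : Matrix (Fin N) (Fin N) ℂ, Dx.IsDiag ∧ X' = V * Dx * Vᴴ) ∧
        (∃ Du : Matrix (Fin N) (Fin N) ℂ, Du.IsDiag ∧ U' = V * Du * Vᴴ) ∧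
        Matrix.trace (X'ᴴ * Q * X') + Matrix.trace (U'ᴴ * R * U')
          ≤ Matrix.trace (Xᴴ * Q * X) + Matrix.trace (Uᴴ * R * U) ∧
        X' = V * Matrix.diagonal (Matrix.diag (Vᴴ * X * V)) * Vᴴ ∧
        U' = V * Matrix.diagonal (Matrix.diag (Vᴴ * U * V)) * Vᴴ := by
  subst hA hB hQ hR
  intro X U h
  refine ⟨_, _, ?_, ⟨_, isDiag_diagonal _, rfl⟩, ⟨_, isDiag_diagonal _, rfl⟩,
    add_le_add (trace_spectral_projection_le hV hV' q hq X)
      (trace_spectral_projection_le hV hV' r hr U), rfl, rfl⟩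
  have hP := congrArg (fun M => V * diagonal (diag (Vᴴ * M * V)) * Vᴴ) h
  simp only [Matrix.sub_mul, Matrix.smul_mul, Matrix.one_mul, Matrix.mul_sub, Matrix.mul_smul,
    diag_sub, diag_smul, ← diagonal_pi_sub, diagonal_smul, Matrix.mul_one, hV', diag_one,
    spectral_projection_mul hV' hDA, spectral_projection_mul hV' hDB] at hP
  rw [Matrix.sub_mul, Matrix.smul_mul, Matrix.one_mul]
  refine hP.trans ?_
  rw [show diagonal (1 : Fin N → ℂ) = 1 from diagonal_one, Matrix.mul_one, hV]
end
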